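/- Let G be a finite simple 3-regular bipartite graph on exactly 2h+8 vertices (h a natural number) having exactly six cycles of length 4, any two distinct 4-cycles of G sharing at most one edge. Then the number of 5-matchings of G satisfies 40·M(G,5) = 81h⁵ + 270h⁴ − 45h³ + 390h² − 216h (i.e. M(G,5) = (81/40)h⁵ + (27/4)h⁴ − (9/8)h³ + (39/4)h² − (27/5)h). -/

import Mathlib

open SimpleGraph

/-- The number of `k`-matchings of a graph `G`: `k`-element sets of pairwise disjoint
edges of `G`, identified with the matching subgraphs of `G` having exactly `k` edges. -/
noncomputable def numMatchings {V : Type*} (G : SimpleGraph V) (k : ℕ) : ℕ :=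
  Set.ncard {H : G.Subgraph | H.IsMatching ∧ H.edgeSet.ncard = k}

/-- The number of subgraphs of `G` isomorphic to the graph `X`. -/
noncomputable def numSubgraphs {V W : Type*} (G : SimpleGraph V) (X : SimpleGraph W) : ℕ :=
  Set.ncard {H : G.Subgraph | Nonempty (H.coe ≃g X)}

section CopyCount

variable {V W : Type*} {G : SimpleGraph V} {A : SimpleGraph W}

/-- The copy of `A` in `G` obtained from an isomorphism of `A` onto a subgraph of `G`. -/
def copyOfIso (H : G.Subgraph) (e : A ≃g H.coe) : Copy A G :=
  H.coeCopy.comp e.toCopy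

theorem toSubgraph_copyOfIso (H : G.Subgraph) (e : A ≃g H.coe) :
    (copyOfIso H e).toSubgraph = H := by
  have : (copyOfIso H e).toHom = H.hom.comp e.toHom := rfl
  simp [Copy.toSubgraph, this, Subgraph.map_comp]

theorem copyOfIso_isoToSubgraph (f : Copy A G) : copyOfIso f.toSubgraph f.isoToSubgraph = f := by
  ext a
  rfl

theorem bijective_copyOfIso :
    Function.Bijective
      (fun p : Σ H : {H : G.Subgraph // Nonempty (H.coe ≃g A)}, (A ≃g H.1.coe) =>
        copyOfIso p.1.1 p.2) := by
  constructor
  · rintro ⟨⟨H, hH⟩, e⟩ ⟨⟨H', hH'⟩, e'⟩ h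
    have hs : H = H' := by
      rw [← toSubgraph_copyOfIso H e, ← toSubgraph_copyOfIso H' e']
      exact congrArg Copy.toSubgraph h
    subst hs
    congr 1
    ext a
    exact DFunLike.congr_fun h a
  · intro f
    exact ⟨⟨⟨f.toSubgraph, ⟨f.isoToSubgraph.symm⟩⟩, f.isoToSubgraph⟩, copyOfIso_isoToSubgraph f⟩

/-- Every subgraph isomorphic to `A` carries one labelled copy of `A` per automorphism of `A`. -/
theorem card_copy_eq_numSubgraphs_mul [Finite V] [Finite W] :
    Nat.card (Copy A G) = numSubgraphs G A * Nat.card (A ≃g A) := by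
  have : Finite (A ≃g A) := Finite.of_injective (fun e => (e : W → W)) DFunLike.coe_injective
  have e : (Σ H : {H : G.Subgraph // Nonempty (H.coe ≃g A)}, (A ≃g H.1.coe)) ≃
      {H : G.Subgraph // Nonempty (H.coe ≃g A)} × (A ≃g A) :=
    (Equiv.sigmaCongrRight fun H =>
      { toFun := fun e => e.trans H.2.some
        invFun := fun e => e.trans H.2.some.symm
        left_inv := fun e => by ext; simp
        right_inv := fun e => by ext; simp }).trans (Equiv.sigmaEquivProd _ _)
  rw [← Nat.card_congr (Equiv.ofBijective _ bijective_copyOfIso), Nat.card_congr e, Nat.card_prod]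
  rfl

theorem card_cycleGraph_four_iso : Nat.card (cycleGraph 4 ≃g cycleGraph 4) = 8 := by
  let e : (cycleGraph 4 ≃g cycleGraph 4) ≃
      {σ : Equiv.Perm (Fin 4) // ∀ a b, (cycleGraph 4).Adj (σ a) (σ b) ↔ (cycleGraph 4).Adj a b} :=
    { toFun := fun e => ⟨e.toEquiv, fun _ _ => e.map_rel_iff⟩
      invFun := fun σ => ⟨σ.1, σ.2 _ _⟩
      left_inv := fun _ => rfl
      right_inv := fun _ => rfl }
  rw [Nat.card_congr e, Nat.card_eq_fintype_card]
  decide +kernel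

/-- Closed walks of length four without repeated vertices. -/
def IsRootedFourCycle (G : SimpleGraph V) (a b c d : V) : Prop :=
  G.Adj a b ∧ G.Adj b c ∧ G.Adj c d ∧ G.Adj d a ∧ a ≠ c ∧ b ≠ d

theorem card_copy_cycleGraph_four :
    Nat.card (Copy (cycleGraph 4) G) =
      Nat.card {p : V × V × V × V // IsRootedFourCycle G p.1 p.2.1 p.2.2.1 p.2.2.2} := by
  refine Nat.card_congr (Equiv.ofBijective (fun f => ⟨(f 0, f 1, f 2, f 3), ?_⟩) ⟨?_, ?_⟩)
  · have hadj : ∀ i j, (cycleGraph 4).Adj i j → G.Adj (f i) (f j) := fun i j h => f.toHom.map_adj h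
    have hne : ∀ i j, i ≠ j → f i ≠ f j := fun i j h => f.injective.ne h
    exact ⟨hadj _ _ (by decide), hadj _ _ (by decide), hadj _ _ (by decide), hadj _ _ (by decide),
      hne _ _ (by decide), hne _ _ (by decide)⟩
  · intro f g h
    have h' := congrArg Subtype.val h
    simp only [Prod.mk.injEq] at h'
    ext i
    fin_cases i
    exacts [h'.1, h'.2.1, h'.2.2.1, h'.2.2.2]
  · rintro ⟨⟨a, b, c, d⟩, hab, hbc, hcd, hda, hac, hbd⟩
    dsimp only at hab hbc hcd hda hac hbd
    refine ⟨⟨⟨![a, b, c, d], ?_⟩, ?_⟩, ?_⟩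
    · intro i j hij
      have key : ∀ i j : Fin 4, (cycleGraph 4).Adj i j →
          G.Adj (![a, b, c, d] i) (![a, b, c, d] j) := by
        intro i j hij
        fin_cases i <;> fin_cases j <;>
          first
          | exact absurd hij (by decide)
          | simp [hab, hbc, hcd, hda, hab.symm, hbc.symm, hcd.symm, hda.symm]
      exact key i j hij
    · have key : Function.Injective ![a, b, c, d] := by
        intro i j hij
        have := hab.ne; have := hbc.ne; have := hcd.ne; have := hda.ne
        fin_cases i <;> fin_cases j <;> simp_all
      exact key
    · rfl

end CopyCount

section MatchingCount

section

variable {V : Type*} {G : SimpleGraph V}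

/-- The subgraph formed by a set of edges of `G`. -/
def subgraphOfEdges (F : Finset (Sym2 V)) (hF : ∀ e ∈ F, e ∈ G.edgeSet) : G.Subgraph where
  verts := {v | ∃ e ∈ F, v ∈ e}
  Adj u v := s(u, v) ∈ F
  adj_sub h := hF _ h
  edge_vert h := ⟨_, h, Sym2.mem_mk_left _ _⟩
  symm := ⟨fun u v h => by rwa [Sym2.eq_swap]⟩

theorem edgeSet_subgraphOfEdges (F : Finset (Sym2 V)) (hF : ∀ e ∈ F, e ∈ G.edgeSet) :
    (subgraphOfEdges F hF).edgeSet = F := by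
  ext e
  induction e with | _ u v => rfl

end

variable {V : Type*} [Fintype V] [DecidableEq V] (G : SimpleGraph V) [DecidableRel G.Adj]

open Classical in
/-- The edge sets of the `k`-matchings of `G` which avoid the vertex set `S`. -/
noncomputable def matchingsAvoiding (S : Finset V) (k : ℕ) : Finset (Finset (Sym2 V)) :=
  {F | (∀ e ∈ F, e ∈ G.edgeSet) ∧ (∀ e ∈ F, ∀ f ∈ F, ∀ v, v ∈ e → v ∈ f → e = f) ∧
    (∀ e ∈ F, ∀ v ∈ S, v ∉ e) ∧ F.card = k}

variable {G}

theorem mem_matchingsAvoiding {S : Finset V} {k : ℕ} {F : Finset (Sym2 V)} :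
    F ∈ matchingsAvoiding G S k ↔ (∀ e ∈ F, e ∈ G.edgeSet) ∧
      (∀ e ∈ F, ∀ f ∈ F, ∀ v, v ∈ e → v ∈ f → e = f) ∧
      (∀ e ∈ F, ∀ v ∈ S, v ∉ e) ∧ F.card = k := by
  simp [matchingsAvoiding]

theorem numMatchings_eq_card (k : ℕ) :
    numMatchings G k = (matchingsAvoiding G ∅ k).card := by
  classical
  rw [numMatchings, ← Set.ncard_coe_finset]
  refine Set.ncard_congr (fun H _ => H.edgeSet.toFinset) ?_ ?_ ?_
  · rintro H ⟨hM, hk⟩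
    rw [Finset.mem_coe, mem_matchingsAvoiding]
    refine ⟨fun e he => H.edgeSet_subset (by simpa using he), ?_, by simp, ?_⟩
    · intro e he f hf v hve hvf
      obtain ⟨a, rfl⟩ := Sym2.mem_iff_exists.1 hve
      obtain ⟨b, rfl⟩ := Sym2.mem_iff_exists.1 hvf
      simp only [Set.mem_toFinset, Subgraph.mem_edgeSet] at he hf
      rw [hM.eq_of_adj_left he hf]
    · rw [← hk, Set.ncard_eq_toFinset_card']
  · rintro H H' ⟨hM, -⟩ ⟨hM', -⟩ h
    have hE : ∀ u v, H.Adj u v ↔ H'.Adj u v := by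
      intro u v
      rw [← Subgraph.mem_edgeSet, ← Subgraph.mem_edgeSet, Set.toFinset_inj.1 h]
    ext u v
    · constructor
      · intro hu
        obtain ⟨w, hw, -⟩ := hM hu
        exact ((hE _ _).1 hw).fst_mem
      · intro hu
        obtain ⟨w, hw, -⟩ := hM' hu
        exact ((hE _ _).2 hw).fst_mem
    · exact hE u v
  · intro F hF
    obtain ⟨h1, h2, -, h4⟩ := mem_matchingsAvoiding.1 (Finset.mem_coe.1 hF)
    refine ⟨subgraphOfEdges F h1, ⟨?_, ?_⟩, ?_⟩
    · rintro v ⟨e, he, hve⟩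
      obtain ⟨a, rfl⟩ := Sym2.mem_iff_exists.1 hve
      refine ⟨a, he, fun b hb => ?_⟩
      have := h2 _ hb _ he v (by simp) (by simp)
      exact Sym2.congr_right.1 this
    · rw [edgeSet_subgraphOfEdges, Set.ncard_coe_finset, h4]
    · ext e
      simp [edgeSet_subgraphOfEdges]

theorem card_matchingsAvoiding_zero (S : Finset V) : (matchingsAvoiding G S 0).card = 1 := by
  rw [Finset.card_eq_one]
  refine ⟨∅, ?_⟩
  ext F
  rw [mem_matchingsAvoiding, Finset.mem_singleton, Finset.card_eq_zero]
  exact ⟨fun h => h.2.2.2, by rintro rfl; simp⟩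

theorem filter_not_covered (S : Finset V) (w : V) (k : ℕ) :
    (matchingsAvoiding G S k).filter (fun F => ∀ e ∈ F, w ∉ e) =
      matchingsAvoiding G (insert w S) k := by
  ext F
  simp only [Finset.mem_filter, mem_matchingsAvoiding, Finset.forall_mem_insert]
  grind

theorem card_filter_mem_edge {S : Finset V} {w y : V} (hwS : w ∉ S) (hyS : y ∉ S)
    (hwy : G.Adj w y) (k : ℕ) :
    ((matchingsAvoiding G S (k + 1)).filter (fun F => s(w, y) ∈ F)).card =
      (matchingsAvoiding G (insert y (insert w S)) k).card := by
  have hnot : ∀ F ∈ matchingsAvoiding G (insert y (insert w S)) k, s(w, y) ∉ F := by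
    intro F hF hmem
    exact (mem_matchingsAvoiding.1 hF).2.2.1 _ hmem y (by simp) (by simp)
  refine Finset.card_nbij' (fun F => F.erase s(w, y)) (fun F => insert s(w, y) F) ?_ ?_ ?_ ?_
  · intro F hF
    simp only [Finset.coe_filter, Set.mem_ofPred_eq, mem_matchingsAvoiding] at hF
    obtain ⟨⟨h1, h2, h3, h4⟩, h5⟩ := hF
    rw [Finset.mem_coe, mem_matchingsAvoiding]
    refine ⟨fun e he => h1 e (Finset.mem_of_mem_erase he),
      fun e he f hf => h2 e (Finset.mem_of_mem_erase he) f (Finset.mem_of_mem_erase hf), ?_, ?_⟩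
    · intro e he' v hv hve
      obtain ⟨hne, he⟩ : e ≠ s(w, y) ∧ e ∈ F := Finset.mem_erase.1 he'
      rw [Finset.mem_insert, Finset.mem_insert] at hv
      rcases hv with rfl | rfl | hv
      · exact hne (h2 e he _ h5 v hve (by simp))
      · exact hne (h2 e he _ h5 v hve (by simp))
      · exact h3 e he v hv hve
    · rw [Finset.card_erase_of_mem h5, h4, Nat.add_sub_cancel]
  · intro F hF
    have hn := hnot F (Finset.mem_coe.1 hF)
    obtain ⟨h1, h2, h3, h4⟩ := mem_matchingsAvoiding.1 (Finset.mem_coe.1 hF)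
    simp only [Finset.coe_filter, Set.mem_ofPred_eq, mem_matchingsAvoiding]
    have hcov : ∀ f ∈ F, ∀ v ∈ s(w, y), v ∉ f := by
      intro f hf v hv
      rcases Sym2.mem_iff.1 hv with rfl | rfl
      · exact h3 f hf v (by simp)
      · exact h3 f hf v (by simp)
    refine ⟨⟨?_, ?_, ?_, ?_⟩, Finset.mem_insert_self _ _⟩
    · rw [Finset.forall_mem_insert]
      exact ⟨hwy, h1⟩
    · intro e he f hf v hve hvf
      rw [Finset.mem_insert] at he hf
      rcases he with rfl | he <;> rcases hf with rfl | hf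
      · rfl
      · exact absurd hvf (hcov f hf v hve)
      · exact absurd hve (hcov e he v hvf)
      · exact h2 e he f hf v hve hvf
    · rw [Finset.forall_mem_insert]
      refine ⟨fun v hv hve => ?_, fun e he v hv => h3 e he v (by simp [hv])⟩
      rcases Sym2.mem_iff.1 hve with rfl | rfl
      · exact hwS hv
      · exact hyS hv
    · rw [Finset.card_insert_of_notMem hn, h4]
  · intro F hF
    simp only [Finset.coe_filter, Set.mem_ofPred_eq] at hF
    exact Finset.insert_erase hF.2
  · intro F hF
    exact Finset.erase_insert (hnot F (Finset.mem_coe.1 hF))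

/-- Splitting the matchings according to the edge which covers a given vertex. -/
theorem card_matchingsAvoiding_succ {S : Finset V} {w : V} (hw : w ∉ S) (k : ℕ) :
    (matchingsAvoiding G S (k + 1)).card = (matchingsAvoiding G (insert w S) (k + 1)).card +
      ∑ y ∈ G.neighborFinset w \ S, (matchingsAvoiding G (insert y (insert w S)) k).card := by
  classical
  rw [← Finset.card_filter_add_card_filter_not (s := matchingsAvoiding G S (k + 1))
    (fun F => ∀ e ∈ F, w ∉ e), filter_not_covered]
  congr 1
  have hU : (matchingsAvoiding G S (k + 1)).filter (fun F => ¬ ∀ e ∈ F, w ∉ e) =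
      (G.neighborFinset w \ S).biUnion
        (fun y => (matchingsAvoiding G S (k + 1)).filter (fun F => s(w, y) ∈ F)) := by
    ext F
    simp only [Finset.mem_filter, Finset.mem_biUnion, Finset.mem_sdiff, mem_neighborFinset,
      not_forall, not_not]
    constructor
    · rintro ⟨hF, e, he, hwe⟩
      obtain ⟨y, rfl⟩ := Sym2.mem_iff_exists.1 hwe
      have h := mem_matchingsAvoiding.1 hF
      exact ⟨y, ⟨h.1 _ he, fun hy => h.2.2.1 _ he y hy (by simp)⟩, hF, he⟩
    · rintro ⟨y, -, hF, he⟩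
      exact ⟨hF, _, he, by simp⟩
  rw [hU, Finset.card_biUnion]
  · refine Finset.sum_congr rfl fun y hy => ?_
    rw [Finset.mem_sdiff, mem_neighborFinset] at hy
    exact card_filter_mem_edge hw hy.2 hy.1 k
  · intro y _ z _ hyz
    rw [Function.onFun, Finset.disjoint_left]
    intro F hF hF'
    rw [Finset.mem_filter] at hF hF'
    have := (mem_matchingsAvoiding.1 hF.1).2.1 _ hF.2 _ hF'.2 w (by simp) (by simp)
    exact hyz (Sym2.congr_right.1 this)

theorem card_uncovered {k : ℕ} {F : Finset (Sym2 V)} (hF : F ∈ matchingsAvoiding G ∅ k) :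
    (Finset.univ.filter (fun v => ∀ e ∈ F, v ∉ e)).card + 2 * k = Fintype.card V := by
  classical
  obtain ⟨h1, h2, -, h4⟩ := mem_matchingsAvoiding.1 hF
  rw [← Finset.card_univ, ← Finset.card_filter_add_card_filter_not (s := Finset.univ)
    (fun v => ∀ e ∈ F, v ∉ e)]
  congr 1
  have hU : Finset.univ.filter (fun v => ¬ ∀ e ∈ F, v ∉ e) = F.biUnion (fun e => e.toFinset) := by
    ext v
    simp
  rw [hU, Finset.card_biUnion]
  · rw [Finset.sum_congr rfl fun e he =>
      Sym2.card_toFinset_of_not_isDiag e (G.not_isDiag_of_mem_edgeSet (h1 e he))]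
    simp [h4, mul_comm]
  · intro e he f hf hne
    rw [Function.onFun, Finset.disjoint_left]
    intro v hv hv'
    exact hne (h2 e he f hf v (by simpa using hv) (by simpa using hv'))

/-- Double counting of the pairs of a `k`-matching and a vertex which it does not cover. -/
theorem sum_card_matchingsAvoiding_singleton (k : ℕ) :
    ∑ v, (matchingsAvoiding G {v} k).card + 2 * k * (matchingsAvoiding G ∅ k).card =
      Fintype.card V * (matchingsAvoiding G ∅ k).card := by
  have h : ∑ v, (matchingsAvoiding G {v} k).card =
      ∑ F ∈ matchingsAvoiding G ∅ k, (Finset.univ.filter (fun v => ∀ e ∈ F, v ∉ e)).card := by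
    simp_rw [← insert_empty_eq, ← filter_not_covered, Finset.card_filter]
    exact Finset.sum_comm
  rw [h, mul_comm (2 * k), mul_comm (Fintype.card V), ← smul_eq_mul, ← Finset.sum_const,
    ← Finset.sum_add_distrib, Finset.sum_congr rfl fun F hF => card_uncovered hF,
    Finset.sum_const, smul_eq_mul]

end MatchingCount

section PathSum

section

variable {V : Type*} [Fintype V] [DecidableEq V] {G : SimpleGraph V}

variable (G) in
/-- The sum of `f` over the closed walks of length four without repeated vertices. -/
noncomputable def fourCycleSum (f : Finset V → ℤ) : ℤ :=
  open Classical in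
  ∑ a, ∑ b, ∑ c, ∑ d, if IsRootedFourCycle G a b c d then f {a, b, c, d} else 0

theorem fourCycleSum_one :
    fourCycleSum G (fun _ => 1) = 8 * numSubgraphs G (cycleGraph 4) := by
  classical
  have h := card_copy_eq_numSubgraphs_mul (G := G) (A := cycleGraph 4)
  rw [card_cycleGraph_four_iso, card_copy_cycleGraph_four, Nat.card_eq_fintype_card,
    Fintype.card_subtype, Finset.card_filter] at h
  simp only [Fintype.sum_prod_type] at h
  rw [fourCycleSum, mul_comm, ← Nat.cast_ofNat (n := 8), ← Nat.cast_mul, ← h]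
  push_cast
  rfl

end

variable {V : Type*} [Fintype V] [DecidableEq V] (G : SimpleGraph V) [DecidableRel G.Adj]

/-- The sum of `f` over the paths of length `j` starting at `w` and avoiding `S`, where `f` is
applied to the union of `S` with the vertices before the last one, and to the last vertex. -/
def pathSum (f : Finset V → V → ℤ) : ℕ → Finset V → V → ℤ
  | 0, S, w => f S w
  | j + 1, S, w => ∑ y ∈ G.neighborFinset w \ S, pathSum f j (insert w S) y

variable {G}

theorem notMem_insert_of_mem_sdiff {S : Finset V} {w y : V} (hy : y ∈ G.neighborFinset w \ S) :
    y ∉ insert w S := by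
  rw [Finset.mem_sdiff, mem_neighborFinset] at hy
  rw [Finset.mem_insert, not_or]
  exact ⟨hy.1.ne', hy.2⟩

theorem pathSum_congr {f g : Finset V → V → ℤ} (hfg : ∀ S, ∀ w ∉ S, f S w = g S w) (j : ℕ)
    {S : Finset V} {w : V} (hw : w ∉ S) : pathSum G f j S w = pathSum G g j S w := by
  induction j generalizing S w with
  | zero => exact hfg S w hw
  | succ j ih => exact Finset.sum_congr rfl fun y hy => ih (notMem_insert_of_mem_sdiff hy)

theorem pathSum_add (f g : Finset V → V → ℤ) (j : ℕ) (S : Finset V) (w : V) :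
    pathSum G (fun S w => f S w + g S w) j S w = pathSum G f j S w + pathSum G g j S w := by
  induction j generalizing S w with
  | zero => rfl
  | succ j ih => simp only [pathSum, ih, Finset.sum_add_distrib]

theorem pathSum_succ_last (f : Finset V → V → ℤ) (j : ℕ) (S : Finset V) (w : V) :
    pathSum G f (j + 1) S w =
      pathSum G (fun S w => ∑ y ∈ G.neighborFinset w \ S, f (insert w S) y) j S w := by
  induction j generalizing S w with
  | zero => rfl
  | succ j ih => exact Finset.sum_congr rfl fun y _ => ih _ y

variable (G) in
/-- The number of pairs of a path of length `j` and a `k`-matching avoiding it. -/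
noncomputable def pathMatchings (j k : ℕ) : ℤ :=
  ∑ v, pathSum G (fun S w => ((matchingsAvoiding G (insert w S) k).card : ℤ)) j ∅ v

variable (G) in
/-- The sum of `pathMatchings G j k` weighted with the number of extensions of each path. -/
noncomputable def pathExtensions (j k : ℕ) : ℤ :=
  ∑ v, pathSum G (fun S w => ((G.neighborFinset w \ S).card : ℤ) *
    (matchingsAvoiding G (insert w S) k).card) j ∅ v

theorem pathExtensions_zero (j : ℕ) : pathExtensions G j 0 = pathMatchings G (j + 1) 0 := by
  refine Finset.sum_congr rfl fun v _ => ?_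
  rw [pathSum_succ_last]
  refine pathSum_congr (fun S w _ => ?_) j (Finset.notMem_empty v)
  simp [card_matchingsAvoiding_zero]

theorem pathExtensions_succ (j k : ℕ) :
    pathExtensions G j (k + 1) = pathMatchings G (j + 1) (k + 1) + pathMatchings G (j + 2) k := by
  rw [pathExtensions, pathMatchings, pathMatchings, ← Finset.sum_add_distrib]
  refine Finset.sum_congr rfl fun v _ => ?_
  rw [pathSum_succ_last _ (j + 1), ← pathSum_add]
  trans pathSum G (fun S _ => ((matchingsAvoiding G S (k + 1)).card : ℤ)) (j + 1) ∅ v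
  · rw [pathSum_succ_last]
    simp
  · refine pathSum_congr (fun S w hw => ?_) (j + 1) (Finset.notMem_empty v)
    rw [card_matchingsAvoiding_succ hw]
    push_cast
    rfl

theorem pathMatchings_zero (k : ℕ) :
    pathMatchings G 0 k = (Fintype.card V - 2 * k) * (matchingsAvoiding G ∅ k).card := by
  have h : pathMatchings G 0 k = ((∑ v, (matchingsAvoiding G {v} k).card : ℕ) : ℤ) := by
    simp [pathMatchings, pathSum]
  have := sum_card_matchingsAvoiding_singleton (G := G) k
  rw [h]
  zify at this ⊢
  linear_combination this

theorem pathMatchings_one (k : ℕ) :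
    pathMatchings G 1 k = 2 * (k + 1) * (matchingsAvoiding G ∅ (k + 1)).card := by
  have h : ∑ v : V, ((matchingsAvoiding G ∅ (k + 1)).card : ℤ) =
      pathMatchings G 0 (k + 1) + pathMatchings G 1 k := by
    rw [pathMatchings, pathMatchings, ← Finset.sum_add_distrib]
    refine Finset.sum_congr rfl fun v _ => ?_
    rw [card_matchingsAvoiding_succ (Finset.notMem_empty v)]
    simp [pathSum]
  rw [pathMatchings_zero, Finset.sum_const, Finset.card_univ, nsmul_eq_mul] at h
  push_cast at h
  linear_combination -h

end PathSum

section Extensions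

variable {V : Type*} [Fintype V] [DecidableEq V] {G : SimpleGraph V} [DecidableRel G.Adj]

theorem card_neighborFinset_sdiff (hreg : G.IsRegularOfDegree 3) (S : Finset V) (w : V) :
    ((G.neighborFinset w \ S).card : ℤ) = 3 - ∑ s ∈ S, if G.Adj w s then 1 else 0 := by
  have h := Finset.card_sdiff_add_card_inter (G.neighborFinset w) S
  have hS : G.neighborFinset w ∩ S = S.filter (G.Adj w) := by
    ext
    simp [and_comm]
  rw [hS, card_neighborFinset_eq_degree, hreg.degree_eq, Finset.card_filter] at h
  zify at h
  linear_combination h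

theorem pathExtensions_at_zero (hreg : G.IsRegularOfDegree 3) (k : ℕ) :
    pathExtensions G 0 k = 3 * pathMatchings G 0 k := by
  simp only [pathExtensions, pathMatchings, pathSum, Finset.mul_sum]
  refine Finset.sum_congr rfl fun v _ => ?_
  rw [card_neighborFinset_sdiff hreg]
  simp

theorem pathExtensions_at_one (hreg : G.IsRegularOfDegree 3) (k : ℕ) :
    pathExtensions G 1 k = 2 * pathMatchings G 1 k := by
  simp only [pathExtensions, pathMatchings, pathSum, Finset.mul_sum]
  refine Finset.sum_congr rfl fun a _ => Finset.sum_congr rfl fun b hb => ?_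
  simp only [Finset.mem_sdiff, mem_neighborFinset] at hb
  rw [card_neighborFinset_sdiff hreg, Finset.sum_insert (Finset.notMem_empty a),
    if_pos hb.1.symm, Finset.sum_empty]
  ring

theorem pathExtensions_at_two (hreg : G.IsRegularOfDegree 3)
    (hthree : ∀ a b c, G.Adj a b → G.Adj b c → ¬ G.Adj c a) (k : ℕ) :
    pathExtensions G 2 k = 2 * pathMatchings G 2 k := by
  simp only [pathExtensions, pathMatchings, pathSum, Finset.mul_sum]
  refine Finset.sum_congr rfl fun a _ => Finset.sum_congr rfl fun b hb =>
    Finset.sum_congr rfl fun c hc => ?_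
  have hb' := notMem_insert_of_mem_sdiff hb
  simp only [Finset.mem_sdiff, mem_neighborFinset] at hb hc
  rw [card_neighborFinset_sdiff hreg, Finset.sum_insert hb',
    Finset.sum_insert (Finset.notMem_empty a), if_pos hc.1.symm, if_neg (hthree a b c hb.1 hc.1),
    Finset.sum_empty]
  ring

theorem fourCycleSum_eq (f : Finset V → ℤ) :
    fourCycleSum G f = ∑ a, ∑ b ∈ G.neighborFinset a \ ∅,
      ∑ c ∈ G.neighborFinset b \ insert a ∅, ∑ d ∈ G.neighborFinset c \ insert b (insert a ∅),
        if G.Adj d a then f (insert d (insert c (insert b (insert a ∅)))) else 0 := by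
  classical
  refine Finset.sum_congr rfl fun a _ => ?_
  symm
  refine Finset.sum_subset_zero_on_sdiff (Finset.subset_univ _) (fun b hb => ?_) fun b hb => ?_
  · refine Finset.sum_eq_zero fun c _ => Finset.sum_eq_zero fun d _ => if_neg fun h => ?_
    simp [h.1] at hb
  refine Finset.sum_subset_zero_on_sdiff (Finset.subset_univ _) (fun c hc => ?_) fun c hc => ?_
  · refine Finset.sum_eq_zero fun d _ => if_neg fun h => ?_
    simp [h.2.1, h.2.2.2.2.1.symm] at hc
  refine Finset.sum_subset_zero_on_sdiff (Finset.subset_univ _) (fun d hd => ?_) fun d hd => ?_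
  · refine if_neg fun h => ?_
    simp [h.2.2.1, h.2.2.2.1.ne, h.2.2.2.2.2.symm] at hd
  simp only [Finset.mem_sdiff, mem_neighborFinset, Finset.mem_insert, Finset.notMem_empty,
    or_false, not_or] at hb hc hd
  have hiff : IsRootedFourCycle G a b c d ↔ G.Adj d a :=
    ⟨fun h => h.2.2.2.1, fun h => ⟨hb.1, hc.1, hd.1, h, Ne.symm hc.2, Ne.symm hd.2.1⟩⟩
  have hset : insert d (insert c (insert b (insert a ∅))) = ({a, b, c, d} : Finset V) := by
    ext
    simp
    tauto
  simp only [hiff, hset]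

theorem pathExtensions_at_three (hreg : G.IsRegularOfDegree 3)
    (hthree : ∀ a b c, G.Adj a b → G.Adj b c → ¬ G.Adj c a) (k : ℕ) :
    pathExtensions G 3 k = 2 * pathMatchings G 3 k -
      fourCycleSum G (fun S => ((matchingsAvoiding G S k).card : ℤ)) := by
  rw [fourCycleSum_eq]
  simp only [pathExtensions, pathMatchings, pathSum, Finset.mul_sum, ← Finset.sum_sub_distrib]
  refine Finset.sum_congr rfl fun a _ => Finset.sum_congr rfl fun b hb =>
    Finset.sum_congr rfl fun c hc => Finset.sum_congr rfl fun d hd => ?_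
  have hb' := notMem_insert_of_mem_sdiff hb
  have hc' := notMem_insert_of_mem_sdiff hc
  simp only [Finset.mem_sdiff, mem_neighborFinset] at hb hc hd
  rw [card_neighborFinset_sdiff hreg, Finset.sum_insert hc', Finset.sum_insert hb',
    Finset.sum_insert (Finset.notMem_empty a)]
  simp only [hd.1.symm, hthree b c d hc.1 hd.1, if_true, if_false, Finset.sum_empty]
  split_ifs <;> ring

/-- Each closed walk of length four extends backwards, in a cubic graph without triangles, by
exactly one vertex outside of it. -/
theorem sum_attached_fourCycle (hreg : G.IsRegularOfDegree 3)
    (hthree : ∀ a b c, G.Adj a b → G.Adj b c → ¬ G.Adj c a) :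
    (∑ a, ∑ b ∈ G.neighborFinset a \ ∅, ∑ c ∈ G.neighborFinset b \ insert a ∅,
      ∑ d ∈ G.neighborFinset c \ insert b (insert a ∅),
        ∑ e ∈ G.neighborFinset d \ insert c (insert b (insert a ∅)),
          if G.Adj e b then 1 else 0) = fourCycleSum G (fun _ => 1) := by
  classical
  have hg : ∀ a, ∀ b ∈ G.neighborFinset a \ ∅, (∑ c ∈ G.neighborFinset b \ insert a ∅,
      ∑ d ∈ G.neighborFinset c \ insert b (insert a ∅),
        ∑ e ∈ G.neighborFinset d \ insert c (insert b (insert a ∅)),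
          if G.Adj e b then (1 : ℤ) else 0) =
      ∑ c, ∑ d, ∑ e,
        if IsRootedFourCycle G b c d e ∧ a ∉ insert c (insert e (∅ : Finset V)) then 1 else 0 := by
    intro a b hb
    refine Finset.sum_subset_zero_on_sdiff (Finset.subset_univ _) (fun c hc => ?_) fun c hc => ?_
    · refine Finset.sum_eq_zero fun d _ => Finset.sum_eq_zero fun e _ => if_neg ?_
      rintro ⟨h, ha⟩
      simp [h.1] at hc ha
      exact ha.1 hc.symm
    refine Finset.sum_subset_zero_on_sdiff (Finset.subset_univ _) (fun d hd => ?_) fun d hd => ?_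
    · refine Finset.sum_eq_zero fun e _ => if_neg ?_
      rintro ⟨h, ha⟩
      simp only [Finset.mem_sdiff, mem_neighborFinset, Finset.mem_insert, Finset.notMem_empty,
        or_false, not_or, Finset.mem_univ, true_and, h.2.1, not_not, h.2.2.2.2.1.symm,
        not_false_eq_true] at hb hc hd
      exact hthree b c d h.1 h.2.1 (hd ▸ hb.1)
    refine Finset.sum_subset_zero_on_sdiff (Finset.subset_univ _) (fun e he => ?_) fun e he => ?_
    · refine if_neg ?_
      rintro ⟨h, ha⟩
      have := h.2.2.2.1.ne
      have := h.2.2.2.2.2.symm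
      simp_all [h.2.2.1]
    simp only [Finset.mem_sdiff, mem_neighborFinset, Finset.mem_insert, Finset.notMem_empty,
      or_false, not_or] at hb hc hd he
    have hiff : (IsRootedFourCycle G b c d e ∧ a ∉ insert c (insert e (∅ : Finset V))) ↔
        G.Adj e b := by
      refine ⟨fun h => h.1.2.2.2.1, fun h => ⟨⟨hc.1, hd.1, he.1, h, Ne.symm hd.2.1,
        Ne.symm he.2.1⟩, ?_⟩⟩
      simp [Ne.symm hc.2, Ne.symm he.2.2.2]
    simp only [hiff]
  rw [Finset.sum_congr rfl fun a _ => Finset.sum_congr rfl (hg a),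
    Finset.sum_comm' (t' := Finset.univ) (s' := fun b => G.neighborFinset b)
      (by simp [G.adj_comm])]
  refine Finset.sum_congr rfl fun b _ => ?_
  rw [Finset.sum_comm]
  refine Finset.sum_congr rfl fun c _ => ?_
  rw [Finset.sum_comm]
  refine Finset.sum_congr rfl fun d _ => ?_
  rw [Finset.sum_comm]
  refine Finset.sum_congr rfl fun e _ => ?_
  by_cases h : IsRootedFourCycle G b c d e
  · have hce : c ∉ insert e (∅ : Finset V) := by simpa using h.2.2.2.2.2
    have := card_neighborFinset_sdiff hreg (insert c (insert e ∅)) b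
    rw [Finset.sum_insert hce, Finset.sum_insert (Finset.notMem_empty e), Finset.sum_empty,
      if_pos h.1, if_pos h.2.2.2.1.symm, Finset.sdiff_eq_filter, Finset.card_filter] at this
    simp only [h, true_and, if_true]
    push_cast at this
    linear_combination this
  · simp [h]

theorem pathExtensions_at_four (hreg : G.IsRegularOfDegree 3)
    (hthree : ∀ a b c, G.Adj a b → G.Adj b c → ¬ G.Adj c a)
    (hfive : ∀ a b c d e, G.Adj a b → G.Adj b c → G.Adj c d → G.Adj d e → ¬ G.Adj e a) :
    pathExtensions G 4 0 = 2 * pathMatchings G 4 0 - fourCycleSum G (fun _ => 1) := by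
  rw [← sum_attached_fourCycle hreg hthree]
  simp only [pathExtensions, pathMatchings, pathSum, Finset.mul_sum, ← Finset.sum_sub_distrib,
    card_matchingsAvoiding_zero]
  refine Finset.sum_congr rfl fun a _ => Finset.sum_congr rfl fun b hb =>
    Finset.sum_congr rfl fun c hc => Finset.sum_congr rfl fun d hd =>
      Finset.sum_congr rfl fun e he => ?_
  have hb' := notMem_insert_of_mem_sdiff hb
  have hc' := notMem_insert_of_mem_sdiff hc
  have hd' := notMem_insert_of_mem_sdiff hd
  simp only [Finset.mem_sdiff, mem_neighborFinset] at hb hc hd he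
  rw [card_neighborFinset_sdiff hreg, Finset.sum_insert hd', Finset.sum_insert hc',
    Finset.sum_insert hb', Finset.sum_insert (Finset.notMem_empty a)]
  simp only [he.1.symm, hthree c d e hd.1 he.1, hfive a b c d e hb.1 hc.1 hd.1 he.1, if_true,
    if_false, Finset.sum_empty]
  split_ifs <;> norm_num

/-- A four-cycle of a cubic graph without triangles meets exactly eight edges. -/
theorem card_matchingsAvoiding_fourCycle (hreg : G.IsRegularOfDegree 3)
    (hthree : ∀ a b c, G.Adj a b → G.Adj b c → ¬ G.Adj c a) {a b c d : V}
    (h : IsRootedFourCycle G a b c d) :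
    ((matchingsAvoiding G {a, b, c, d} 1).card : ℤ) = (matchingsAvoiding G ∅ 1).card - 8 := by
  obtain ⟨hab, hbc, hcd, hda, hac, hbd⟩ := h
  have step : ∀ (S : Finset V) (w : V), w ∉ S → ((matchingsAvoiding G S 1).card : ℤ) =
      (matchingsAvoiding G (insert w S) 1).card +
        (3 - ∑ s ∈ S, if G.Adj w s then 1 else 0) := by
    intro S w hw
    rw [card_matchingsAvoiding_succ hw, ← card_neighborFinset_sdiff hreg]
    simp [card_matchingsAvoiding_zero]
  have hd := step ∅ d (by simp)
  have hc := step {d} c (by simp [hcd.ne])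
  have hb := step {c, d} b (by simp [hbc.ne, hbd])
  have ha := step {b, c, d} a (by simp [hab.ne, hac, hda.ne'])
  rw [Finset.sum_insert (by simp [hbc.ne, hbd]), Finset.sum_insert (by simp [hcd.ne]),
    Finset.sum_singleton, if_pos hab, if_pos hda.symm,
    if_neg fun h => hthree a b c hab hbc h.symm] at ha
  rw [Finset.sum_insert (by simp [hcd.ne]), Finset.sum_singleton, if_pos hbc,
    if_neg fun h => hthree b c d hbc hcd h.symm] at hb
  rw [Finset.sum_singleton, if_pos hcd] at hc
  rw [Finset.sum_empty, insert_empty_eq] at hd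
  linarith

theorem fourCycleSum_card_matchingsAvoiding_one (hreg : G.IsRegularOfDegree 3)
    (hthree : ∀ a b c, G.Adj a b → G.Adj b c → ¬ G.Adj c a) :
    fourCycleSum G (fun S => ((matchingsAvoiding G S 1).card : ℤ)) =
      fourCycleSum G (fun _ => 1) * ((matchingsAvoiding G ∅ 1).card - 8) := by
  simp only [fourCycleSum, Finset.sum_mul]
  refine Finset.sum_congr rfl fun a _ => Finset.sum_congr rfl fun b _ =>
    Finset.sum_congr rfl fun c _ => Finset.sum_congr rfl fun d _ => ?_
  split_ifs with h
  · rw [card_matchingsAvoiding_fourCycle hreg hthree h, one_mul]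
  · rw [zero_mul]

end Extensions

theorem stmt_14 {V : Type*} [Fintype V] [DecidableEq V] (G : SimpleGraph V) [DecidableRel G.Adj]
    (hreg : G.IsRegularOfDegree 3) (hbip : G.Colorable 2) (h : ℕ)
    (hcard : Fintype.card V = 2 * h + 8)
    (hsix : numSubgraphs G (cycleGraph 4) = 6)
    (hshare : ∀ H₁ H₂ : G.Subgraph, Nonempty (H₁.coe ≃g cycleGraph 4) →
      Nonempty (H₂.coe ≃g cycleGraph 4) → H₁ ≠ H₂ →
      (H₁.edgeSet ∩ H₂.edgeSet).ncard ≤ 1) :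
    (40 * numMatchings G 5 : ℤ) =
      81 * (h : ℤ) ^ 5 + 270 * (h : ℤ) ^ 4 - 45 * (h : ℤ) ^ 3 + 390 * (h : ℤ) ^ 2 - 216 * (h : ℤ) := by
  obtain ⟨C⟩ := hbip
  have hthree : ∀ a b c, G.Adj a b → G.Adj b c → ¬ G.Adj c a := by
    intro a b c hab hbc hca
    have := C.valid hab
    have := C.valid hbc
    have := C.valid hca
    omega
  have hfive : ∀ a b c d e, G.Adj a b → G.Adj b c → G.Adj c d → G.Adj d e → ¬ G.Adj e a := by
    intro a b c d e hab hbc hcd hde hea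
    have := C.valid hab
    have := C.valid hbc
    have := C.valid hcd
    have := C.valid hde
    have := C.valid hea
    omega
  have hcyc : fourCycleSum G (fun _ => 1) = 48 := by
    rw [fourCycleSum_one, hsix]
    norm_num
  have hcyc_one := fourCycleSum_card_matchingsAvoiding_one hreg hthree
  have e0 := pathExtensions_at_zero hreg
  have e1 := pathExtensions_at_one hreg
  have e2 := pathExtensions_at_two hreg hthree
  have e3 := pathExtensions_at_three hreg hthree
  have e4 := pathExtensions_at_four hreg hthree hfive
  have e30 : pathExtensions G 3 0 = 2 * pathMatchings G 3 0 - 48 := by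
    rw [e3, ← hcyc]
    simp [card_matchingsAvoiding_zero]
  have e31 := e3 1
  rw [hcyc_one, hcyc] at e31
  rw [hcyc] at e4
  rw [pathExtensions_zero] at e30 e4
  rw [pathExtensions_succ] at e31
  have z0 := e0 0
  have z1 := e1 0
  have z2 := e2 0
  rw [pathExtensions_zero] at z0 z1 z2
  have s0 := fun k => e0 (k + 1)
  have s1 := fun k => e1 (k + 1)
  have s2 := fun k => e2 (k + 1)
  simp only [pathExtensions_succ] at s0 s1 s2
  have p0 := pathMatchings_zero (G := G)
  have p1 := pathMatchings_one (G := G)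
  have n0 := card_matchingsAvoiding_zero (G := G) ∅
  simp only [hcard] at p0
  rw [numMatchings_eq_card]
  have s00 := s0 0
  have s01 := s0 1
  have s02 := s0 2
  have s03 := s0 3
  have s10 := s1 0
  have s11 := s1 1
  have s12 := s1 2
  have s20 := s2 0
  have s21 := s2 1
  simp only [p0, p1, n0, zero_add, Nat.reduceAdd] at z0 z1 z2 s00 s01 s02 s03 s10 s11 s12 s20 s21
  push_cast at z0 z1 s00 s01 s02 s03 s10 s11 s12
  have m1 : ((matchingsAvoiding G ∅ 1).card : ℤ) = 3 * h + 12 := by linarith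
  rw [m1] at s00 e31 z1
  have m2 : 2 * ((matchingsAvoiding G ∅ 2).card : ℤ) = 9 * h ^ 2 + 57 * h + 84 := by linarith
  have m3 : 2 * ((matchingsAvoiding G ∅ 3).card : ℤ) =
      9 * h ^ 3 + 63 * h ^ 2 + 130 * h + 88 := by
    linarith [congrArg (fun x => (h : ℤ) * x) m2]
  have m4 : 8 * ((matchingsAvoiding G ∅ 4).card : ℤ) =
      27 * h ^ 4 + 162 * h ^ 3 + 273 * h ^ 2 + 234 * h + 72 := by
    linarith [congrArg (fun x => (h : ℤ) * x) m3]
  linarith [congrArg (fun x => (h : ℤ) * x) m4]
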